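/- arXiv:2501.07903 — 2 statements merged into one kernel-verified Lean document; each statement's English description precedes it below -/
import Mathlib

section
/- Lipschitz property of the split score in the split index: for a dataset D, depth d ≥ 1, feature f : Fin p, and any two thresholds τ and τ', the optimal split scores satisfy |Split(D, d, f, τ) − Split(D, d, f, τ')| ≤ |z_f(τ) − z_f(τ')| (as integers). -/
open scoped Classical

/-- A binary axis-aligned decision tree over `p` features with labels in `Y`:
either a leaf carrying a label, or a node carrying a feature, a threshold,
and two subtrees. -/
inductive DTree (p : ℕ) (Y : Type) : Type
  | leaf (lab : Y) : DTree p Y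
  | node (f : Fin p) (τ : ℝ) (l r : DTree p Y) : DTree p Y

namespace DTree

/-- A leaf classifies every `x` as its label; a node classifies `x` by the left
subtree if `x f ≤ τ` and by the right subtree otherwise. -/
noncomputable def classify {p : ℕ} {Y : Type} : DTree p Y → (Fin p → ℝ) → Y
  | leaf lab, _ => lab
  | node f τ l r, x => if x f ≤ τ then l.classify x else r.classify x

/-- The depth of a leaf is 0; the depth of a node is 1 plus the maximum of the
depths of its subtrees. -/
def depth {p : ℕ} {Y : Type} : DTree p Y → ℕ
  | leaf _ => 0
  | node _ _ l r => 1 + max l.depth r.depth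

end DTree

/-- `errors t D` is the number of observations of `D` misclassified by `t`. -/
noncomputable def errors {p : ℕ} {Y : Type} (t : DTree p Y)
    (D : Multiset ((Fin p → ℝ) × Y)) : ℕ :=
  (D.map fun xy => if t.classify xy.1 = xy.2 then 0 else 1).sum

/-- `theta D d`: the optimal misclassification score, i.e. the minimum of
`errors t D` over all decision trees `t` of depth at most `d`. -/
noncomputable def theta {p : ℕ} {Y : Type} (D : Multiset ((Fin p → ℝ) × Y))
    (d : ℕ) : ℕ :=
  sInf {n | ∃ t : DTree p Y, t.depth ≤ d ∧ errors t D = n}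

/-- `dle D f τ = D(f ≤ τ)`: the sub-multiset of observations with `x f ≤ τ`. -/
noncomputable def dle {p : ℕ} {Y : Type} (D : Multiset ((Fin p → ℝ) × Y))
    (f : Fin p) (τ : ℝ) : Multiset ((Fin p → ℝ) × Y) :=
  D.filter fun xy => xy.1 f ≤ τ

/-- `dgt D f τ = D(f > τ)`: the sub-multiset of observations with `x f > τ`. -/
noncomputable def dgt {p : ℕ} {Y : Type} (D : Multiset ((Fin p → ℝ) × Y))
    (f : Fin p) (τ : ℝ) : Multiset ((Fin p → ℝ) × Y) :=
  D.filter fun xy => τ < xy.1 f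

/-- `zf D f τ = z_f(τ) := card(D(f ≤ τ))`. -/
noncomputable def zf {p : ℕ} {Y : Type} (D : Multiset ((Fin p → ℝ) × Y))
    (f : Fin p) (τ : ℝ) : ℕ :=
  (dle D f τ).card

/-- `splitScore D d f τ = Split(D, d, f, τ) := θ(D(f ≤ τ), d−1) + θ(D(f > τ), d−1)`. -/
noncomputable def splitScore {p : ℕ} {Y : Type} (D : Multiset ((Fin p → ℝ) × Y))
    (d : ℕ) (f : Fin p) (τ : ℝ) : ℕ :=
  theta (dle D f τ) (d - 1) + theta (dgt D f τ) (d - 1)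

/-- The multiset of values of feature `f` in `D`. -/
noncomputable def featureVals {p : ℕ} {Y : Type} (D : Multiset ((Fin p → ℝ) × Y))
    (f : Fin p) : Multiset ℝ :=
  D.map fun xy => xy.1 f

/-- `midpoints D f = S^f`: the set of midpoints `(a + b) / 2` over all pairs
`a < b` of consecutive distinct values of feature `f` in `D` (i.e. no feature
value lies strictly between `a` and `b`). -/
noncomputable def midpoints {p : ℕ} {Y : Type} (D : Multiset ((Fin p → ℝ) × Y))
    (f : Fin p) : Set ℝ :=
  {m | ∃ a b : ℝ, a ∈ featureVals D f ∧ b ∈ featureVals D f ∧ a < b ∧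
    (∀ c ∈ featureVals D f, ¬(a < c ∧ c < b)) ∧ m = (a + b) / 2}

/-- `leafScore D = L(D)`: the best leaf score, the minimum over labels `ŷ` of
the number of observations of `D` whose label differs from `ŷ`. -/
noncomputable def leafScore {p : ℕ} {Y : Type} (D : Multiset ((Fin p → ℝ) × Y)) : ℕ :=
  sInf {n | ∃ lab : Y, n = (D.map fun xy => if xy.2 = lab then 0 else 1).sum}

theorem errors_add {p : ℕ} {Y : Type} (t : DTree p Y) (A B : Multiset ((Fin p → ℝ) × Y)) :
    errors t (A + B) = errors t A + errors t B := by
  simp [errors]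

theorem errors_le_card {p : ℕ} {Y : Type} (t : DTree p Y) (A : Multiset ((Fin p → ℝ) × Y)) :
    errors t A ≤ A.card := by
  have h := Multiset.sum_le_card_nsmul
    (A.map fun xy => if t.classify xy.1 = xy.2 then 0 else 1) 1 (by
      intro n hn
      obtain ⟨a, -, rfl⟩ := Multiset.mem_map.1 hn
      split_ifs <;> simp)
  simpa [errors] using h

theorem exists_errors_eq_theta {p : ℕ} {Y : Type} [Nonempty Y]
    (A : Multiset ((Fin p → ℝ) × Y)) (d : ℕ) :
    ∃ t : DTree p Y, t.depth ≤ d ∧ errors t A = theta A d :=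
  Nat.sInf_mem (s := {n | ∃ t : DTree p Y, t.depth ≤ d ∧ errors t A = n})
    ⟨_, .leaf (Classical.arbitrary Y), Nat.zero_le d, rfl⟩

theorem theta_le_errors {p : ℕ} {Y : Type} (A : Multiset ((Fin p → ℝ) × Y)) {d : ℕ}
    {t : DTree p Y} (ht : t.depth ≤ d) : theta A d ≤ errors t A :=
  Nat.sInf_le ⟨t, ht, rfl⟩

theorem theta_le_theta_add {p : ℕ} {Y : Type} [Nonempty Y]
    (A B : Multiset ((Fin p → ℝ) × Y)) (d : ℕ) : theta A d ≤ theta (A + B) d := by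
  obtain ⟨t, ht, h⟩ := exists_errors_eq_theta (A + B) d
  have := theta_le_errors A ht
  rw [errors_add] at h
  omega

theorem theta_add_le {p : ℕ} {Y : Type} [Nonempty Y]
    (A B : Multiset ((Fin p → ℝ) × Y)) (d : ℕ) : theta (A + B) d ≤ theta A d + B.card := by
  obtain ⟨t, ht, h⟩ := exists_errors_eq_theta A d
  have := theta_le_errors (A + B) ht
  have := errors_le_card t B
  rw [errors_add] at *
  omega

theorem dle_eq_add {p : ℕ} {Y : Type} (D : Multiset ((Fin p → ℝ) × Y)) (f : Fin p)
    {τ τ' : ℝ} (h : τ ≤ τ') : dle D f τ' = dle D f τ + dle (dgt D f τ) f τ' := by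
  rw [← Multiset.filter_add_not (fun xy => xy.1 f ≤ τ) (dle D f τ')]
  simp only [dle, dgt, Multiset.filter_filter, not_le]
  congr 1 <;> refine Multiset.filter_congr fun xy _ => ?_ <;> grind

theorem dgt_eq_add {p : ℕ} {Y : Type} (D : Multiset ((Fin p → ℝ) × Y)) (f : Fin p)
    {τ τ' : ℝ} (h : τ ≤ τ') : dgt D f τ = dgt D f τ' + dle (dgt D f τ) f τ' := by
  conv_lhs => rw [← Multiset.filter_add_not (fun xy => τ' < xy.1 f) (dgt D f τ)]
  simp only [dle, dgt, Multiset.filter_filter, not_lt]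
  congr 1
  refine Multiset.filter_congr fun xy _ => ?_
  grind

/-- Lipschitz property of the split score in the split index: for `d ≥ 1` and
any two thresholds `τ` and `τ'`,
`|Split(D, d, f, τ) − Split(D, d, f, τ')| ≤ |z_f(τ) − z_f(τ')|` as integers. -/
theorem splitScore_lipschitz {p : ℕ} {Y : Type} [Fintype Y] [Nonempty Y]
    (D : Multiset ((Fin p → ℝ) × Y)) (d : ℕ) (hd : 1 ≤ d) (f : Fin p) (τ τ' : ℝ) :
    |(splitScore D d f τ : ℤ) - (splitScore D d f τ' : ℤ)| ≤
      |(zf D f τ : ℤ) - (zf D f τ' : ℤ)| := by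
  wlog h : τ ≤ τ' generalizing τ τ'
  · rw [abs_sub_comm, abs_sub_comm (zf D f τ : ℤ)]
    exact this τ' τ (le_of_not_ge h)
  have hz : zf D f τ' = zf D f τ + (dle (dgt D f τ) f τ').card := by
    simp only [zf]
    rw [dle_eq_add D f h, Multiset.card_add]
  have hl := theta_le_theta_add (dle D f τ) (dle (dgt D f τ) f τ') (d - 1)
  have hl' := theta_add_le (dle D f τ) (dle (dgt D f τ) f τ') (d - 1)
  have hr := theta_le_theta_add (dgt D f τ') (dle (dgt D f τ) f τ') (d - 1)
  have hr' := theta_add_le (dgt D f τ') (dle (dgt D f τ) f τ') (d - 1)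
  rw [← dle_eq_add D f h] at hl hl'
  rw [← dgt_eq_add D f h] at hr hr'
  simp only [splitScore]
  grind
end

section
/- Theorem 3 (sub-interval pruning): let D be a dataset, d ≥ 1, f : Fin p a feature, UB a natural number, and u ≤ w ≤ v thresholds. If θ(D(f ≤ u), d−1) + θ(D(f > v), d−1) > UB, then the split at w cannot improve on UB: Split(D, d, f, w) > UB. -/
open scoped Classical

theorem errors_mono {p : ℕ} {Y : Type} (t : DTree p Y)
    {D E : Multiset ((Fin p → ℝ) × Y)} (hDE : D ≤ E) : errors t D ≤ errors t E := by
  obtain ⟨F, rfl⟩ := Multiset.le_iff_exists_add.mp hDE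
  simp [errors]

theorem theta_mono {p : ℕ} {Y : Type} [Nonempty Y]
    {D E : Multiset ((Fin p → ℝ) × Y)} (hDE : D ≤ E) (d : ℕ) : theta D d ≤ theta E d := by
  have hne : {n | ∃ t : DTree p Y, t.depth ≤ d ∧ errors t E = n}.Nonempty :=
    ⟨_, .leaf (Classical.arbitrary Y), Nat.zero_le d, rfl⟩
  obtain ⟨t, ht, hE⟩ := Nat.sInf_mem hne
  calc theta D d ≤ errors t D := Nat.sInf_le ⟨t, ht, rfl⟩
    _ ≤ errors t E := errors_mono t hDE
    _ = theta E d := hE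

theorem dle_mono {p : ℕ} {Y : Type} (D : Multiset ((Fin p → ℝ) × Y)) (f : Fin p)
    {u w : ℝ} (huw : u ≤ w) : dle D f u ≤ dle D f w :=
  Multiset.monotone_filter_right D fun _ h => h.trans huw

theorem dgt_anti {p : ℕ} {Y : Type} (D : Multiset ((Fin p → ℝ) × Y)) (f : Fin p)
    {w v : ℝ} (hwv : w ≤ v) : dgt D f v ≤ dgt D f w :=
  Multiset.monotone_filter_right D fun _ h => hwv.trans_lt h

/-- Theorem 3 (sub-interval pruning): for thresholds `u ≤ w ≤ v`, if
`θ(D(f ≤ u), d−1) + θ(D(f > v), d−1) > UB`, then the split at `w` cannot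
improve on `UB`: `Split(D, d, f, w) > UB`. -/
theorem sub_interval_pruning {p : ℕ} {Y : Type} [Fintype Y] [Nonempty Y]
    (D : Multiset ((Fin p → ℝ) × Y)) (d : ℕ) (hd : 1 ≤ d) (f : Fin p)
    (UB : ℕ) (u w v : ℝ) (huw : u ≤ w) (hwv : w ≤ v)
    (h : theta (dle D f u) (d - 1) + theta (dgt D f v) (d - 1) > UB) :
    splitScore D d f w > UB := by
  exact h.trans_le (Nat.add_le_add (theta_mono (dle_mono D f huw) _)
    (theta_mono (dgt_anti D f hwv) _))
end
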